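/- arXiv:2403.09423 — 6 statements merged into one kernel-verified Lean document; each statement's English description precedes it below -/
import Mathlib

section
/- Let G be a finite group. The commuting conjugacy class graph of G is complete (i.e., for all a, b ∈ G lying in distinct conjugacy classes there exist x conjugate to a and y conjugate to b such that x and y commute) if and only if G is abelian. -/
/-- If every element of a finite group acting transitively on a finite type has a fixed point,
then the action is on a type with at most one element. -/
theorem subsingleton_of_forall_fixedBy_nonempty {G X : Type*} [Group G] [Finite G]
    [MulAction G X] [Finite X] [MulAction.IsPretransitive G X]
    (h : ∀ g : G, (MulAction.fixedBy X g).Nonempty) : Subsingleton X := by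
  classical
  have := Fintype.ofFinite G
  have := Fintype.ofFinite X
  have : Fintype (MulAction.orbitRel.Quotient G X) := Fintype.ofFinite _
  have hsum := MulAction.sum_card_fixedBy_eq_card_orbits_mul_card_group G X
  have hquot : Fintype.card (MulAction.orbitRel.Quotient G X) ≤ 1 :=
    Fintype.card_le_one_iff_subsingleton.2
      (MulAction.pretransitive_iff_subsingleton_quotient G X |>.1 inferInstance)
  rw [← not_nontrivial_iff_subsingleton]
  intro hX
  have hlt : ∑ _g : G, 1 < ∑ g : G, Fintype.card (MulAction.fixedBy X g) := by
    refine Finset.sum_lt_sum (fun g _ ↦ ?_) ⟨1, Finset.mem_univ _, ?_⟩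
    · exact Fintype.card_pos_iff.2 (h g).to_subtype
    · rw [Fintype.one_lt_card_iff_nontrivial, MulAction.fixedBy_one_eq_univ]
      exact Set.nontrivial_coe_sort.2 Set.nontrivial_univ
  have hcard : ∑ _g : G, 1 = Fintype.card G := by simp
  nlinarith

/-- In a finite group, an element having a conjugate commuting with each element is central. -/
theorem commute_of_forall_exists_isConj_commute {G : Type*} [Group G] [Finite G] {a : G}
    (h : ∀ g : G, ∃ x, IsConj a x ∧ Commute x g) (b : G) : Commute a b := by
  have : Subsingleton (G ⧸ Subgroup.centralizer {a}) := by
    refine subsingleton_of_forall_fixedBy_nonempty (G := G) fun g ↦ ?_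
    obtain ⟨x, hx, hxg⟩ := h g
    obtain ⟨c, rfl⟩ := isConj_iff.1 hx
    refine ⟨(c : G ⧸ Subgroup.centralizer {a}), ?_⟩
    rw [MulAction.mem_fixedBy, MulAction.Quotient.smul_coe, eq_comm, QuotientGroup.eq,
      Subgroup.mem_centralizer_singleton_iff, smul_eq_mul]
    have hxg' : c * a * c⁻¹ * g = g * (c * a * c⁻¹) := hxg
    calc c⁻¹ * (g * c) * a = c⁻¹ * (g * (c * a * c⁻¹)) * c := by group
      _ = a * (c⁻¹ * (g * c)) := by rw [← hxg']; group
  have hb : b ∈ Subgroup.centralizer {a} := by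
    rw [QuotientGroup.subgroup_eq_top_of_subsingleton _ this]
    exact Subgroup.mem_top b
  exact (Subgroup.mem_centralizer_singleton_iff.1 hb).symm

/-- The commuting conjugacy class graph of a finite group `G` is complete if and only if
`G` is abelian. -/
theorem stmt3 {G : Type*} [Group G] [Finite G] :
    (∀ a b : G, ¬ IsConj a b → ∃ x y : G, IsConj a x ∧ IsConj b y ∧ Commute x y) ↔
      (∀ a b : G, a * b = b * a) := by
  refine ⟨fun h a ↦ commute_of_forall_exists_isConj_commute fun g ↦ ?_,
    fun h a b _ ↦ ⟨a, b, IsConj.refl a, IsConj.refl b, h a b⟩⟩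
  by_cases hag : IsConj a g
  · exact ⟨g, hag, Commute.refl g⟩
  · obtain ⟨x, y, hx, hy, hxy⟩ := h a g hag
    obtain ⟨c, rfl⟩ := isConj_iff.1 hy.symm
    exact ⟨c * x * c⁻¹, hx.trans (isConj_iff.2 ⟨c, rfl⟩), (Commute.conj_iff c).2 hxy⟩
end

section
/- Let H be a proper subgroup of a finite group G. Then G has a conjugacy class disjoint from H; that is, there exists g ∈ G such that no conjugate x⁻¹ g x (x ∈ G) lies in H. -/
/-- Jordan's theorem: a transitive action of a finite group on a finite set with at least two
points has an element without fixed points. -/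
theorem MulAction.exists_fixedBy_eq_empty {G X : Type*} [Group G] [Finite G] [MulAction G X]
    [MulAction.IsPretransitive G X] [Finite X] [Nontrivial X] :
    ∃ g : G, MulAction.fixedBy X g = ∅ := by
  classical
  have := Fintype.ofFinite G
  have := Fintype.ofFinite X
  have : Fintype (Quotient (MulAction.orbitRel G X)) := Fintype.ofFinite _
  by_contra! h
  have burnside := MulAction.sum_card_fixedBy_eq_card_orbits_mul_card_group G X
  have orbits : Fintype.card (Quotient (MulAction.orbitRel G X)) ≤ 1 :=
    Fintype.card_le_one_iff_subsingleton.mpr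
      ((MulAction.pretransitive_iff_subsingleton_quotient G X).mp inferInstance)
  have lt : ∑ _g : G, 1 < ∑ g : G, Fintype.card (MulAction.fixedBy X g) := by
    refine Finset.sum_lt_sum (fun g _ => ?_) ⟨1, Finset.mem_univ _, ?_⟩
    · exact Fintype.card_pos_iff.mpr (h g).to_subtype
    · simpa [MulAction.fixedBy] using Fintype.one_lt_card (α := X)
  rw [burnside, Finset.sum_const, Finset.card_univ, smul_eq_mul, mul_one] at lt
  nlinarith

/-- A proper subgroup of a finite group misses some conjugacy class entirely: there is
`g ∈ G` no conjugate of which lies in `H`. -/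
theorem stmt6 {G : Type*} [Group G] [Finite G] (H : Subgroup G) (hH : H ≠ ⊤) :
    ∃ g : G, ∀ x : G, x⁻¹ * g * x ∉ H := by
  have : Nontrivial (G ⧸ H) := not_subsingleton_iff_nontrivial.mp
    (hH ∘ QuotientGroup.subgroup_eq_top_of_subsingleton H)
  obtain ⟨g, hg⟩ := MulAction.exists_fixedBy_eq_empty (G := G) (X := G ⧸ H)
  refine ⟨g, fun x hx => Set.eq_empty_iff_forall_notMem.mp hg (x : G ⧸ H) ?_⟩
  refine (QuotientGroup.eq.mpr ?_ : (x : G ⧸ H) = ((g * x : G) : G ⧸ H)).symm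
  rwa [← mul_assoc]
end

section
/- Let G be a finite group and g ∈ G. The conjugacy class of g is a dominant vertex of the commuting conjugacy class graph of G (i.e., for every h ∈ G there exists x ∈ G such that g commutes with x⁻¹ h x) if and only if g lies in the centre Z(G) of G. -/
/-- If a finite group acts transitively on a nonempty type with every element having a fixed
point, then the type is a singleton. -/
theorem MulAction.card_eq_one_of_fixedBy_nonempty {G X : Type*} [Group G] [Finite G]
    [MulAction G X] [Finite X] [MulAction.IsPretransitive G X] [Nonempty X]
    (h : ∀ g : G, (MulAction.fixedBy X g).Nonempty) : Nat.card X = 1 := by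
  classical
  have := Fintype.ofFinite G
  have := Fintype.ofFinite X
  have hsum := MulAction.sum_card_fixedBy_eq_card_orbits_mul_card_group G X
  have horb : Fintype.card (Quotient (MulAction.orbitRel G X)) = 1 := by
    obtain ⟨x⟩ := ‹Nonempty X›
    refine Fintype.card_eq_one_iff.mpr ⟨⟦x⟧, fun q => ?_⟩
    induction q using Quotient.inductionOn with
    | h y => exact Quotient.sound (MulAction.exists_smul_eq G x y)
  have hle : ∀ g ∈ (Finset.univ : Finset G), 1 ≤ Fintype.card (MulAction.fixedBy X g) :=
    fun g _ => Fintype.card_pos_iff.mpr (h g).to_subtype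
  have heq := (Finset.sum_eq_sum_iff_of_le hle).mp (by rw [hsum, horb]; simp) 1 (Finset.mem_univ _)
  rw [Nat.card_eq_fintype_card, ← Fintype.card_congr (Equiv.Set.univ X), heq]
  exact Fintype.card_congr (Equiv.setCongr (MulAction.fixedBy_one_eq_univ X G).symm)

/-- A subgroup of a finite group that meets every conjugacy class is the whole group. -/
theorem Subgroup.eq_top_of_forall_exists_conj_mem {G : Type*} [Group G] [Finite G]
    (H : Subgroup G) (h : ∀ g : G, ∃ x : G, x⁻¹ * g * x ∈ H) : H = ⊤ := by
  rw [← Subgroup.index_eq_one]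
  refine MulAction.card_eq_one_of_fixedBy_nonempty (G := G) fun g => ?_
  obtain ⟨x, hx⟩ := h g
  refine ⟨(x : G ⧸ H), ?_⟩
  rw [MulAction.mem_fixedBy, MulAction.Quotient.smul_coe, eq_comm, QuotientGroup.eq]
  simpa [mul_assoc] using hx

/-- The conjugacy class of `g` is a dominant vertex of the commuting conjugacy class graph
of a finite group `G` if and only if `g` is central. -/
theorem stmt7 {G : Type*} [Group G] [Finite G] (g : G) :
    (∀ h : G, ∃ x : G, Commute g (x⁻¹ * h * x)) ↔ g ∈ Subgroup.center G := by
  constructor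
  · intro h
    have htop : Subgroup.centralizer {g} = ⊤ :=
      Subgroup.eq_top_of_forall_exists_conj_mem _ fun a => by
        obtain ⟨x, hx⟩ := h a
        exact ⟨x, Subgroup.mem_centralizer_singleton_iff.mpr hx.eq.symm⟩
    refine Subgroup.mem_center_iff.mpr fun a => ?_
    exact Subgroup.mem_centralizer_singleton_iff.mp (htop ▸ Subgroup.mem_top a)
  · exact fun hg h => ⟨1, (Subgroup.mem_center_iff.mp hg _).symm⟩
end

section
/- Let G be a finite group. The following are equivalent: (1) for all g, h ∈ G, if there exist x, y ∈ G such that x⁻¹ g x commutes with y⁻¹ h y, then g commutes with h; (2) G is a 2-Engel group, i.e., G satisfies the identity [[x, y], y] = 1 for all x, y ∈ G. -/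
/-- In a 2-Engel group, `x ^ (y * y) = x ^ y * x⁻¹ * x ^ y`, where `x ^ y = y⁻¹ * x * y`. -/
theorem conj_mul_self_of_two_engel {G : Type*} [Group G] {x y : G}
    (h : (x⁻¹ * y⁻¹ * x * y)⁻¹ * y⁻¹ * (x⁻¹ * y⁻¹ * x * y) * y = 1) :
    (y * y)⁻¹ * x * (y * y) = (y⁻¹ * x * y) * x⁻¹ * (y⁻¹ * x * y) := by
  have h' : (y⁻¹ * x * y)⁻¹ * ((y * y)⁻¹ * x * (y * y)) = x⁻¹ * (y⁻¹ * x * y) :=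
    calc _ = (x⁻¹ * y⁻¹ * x * y) *
          ((x⁻¹ * y⁻¹ * x * y)⁻¹ * y⁻¹ * (x⁻¹ * y⁻¹ * x * y) * y) := by group
      _ = _ := by rw [h]; group
  rw [inv_mul_eq_iff_eq_mul.mp h', ← mul_assoc]

/-- In a 2-Engel group, an element commuting with a conjugate of `h` commutes with `h`. -/
theorem Commute.of_conj_of_two_engel {G : Type*} [Group G]
    (hG : ∀ x y : G, (x⁻¹ * y⁻¹ * x * y)⁻¹ * y⁻¹ * (x⁻¹ * y⁻¹ * x * y) * y = 1)
    {g h z : G} (hc : Commute g (z⁻¹ * h * z)) : Commute g h := by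
  have hb : g⁻¹ * (z⁻¹ * h * z) * g = z⁻¹ * h * z := by
    rw [mul_assoc, ← hc.eq, inv_mul_cancel_left]
  have hzg : (z * g)⁻¹ * h * (z * g) = z⁻¹ * h * z := by
    rw [← hb]; group
  have h₁ := conj_mul_self_of_two_engel (hG h z)
  have h₂ := conj_mul_self_of_two_engel (hG h (z * g))
  rw [hzg] at h₂
  have h₃ : (z * g * (z * g))⁻¹ * h * (z * g * (z * g)) =
      (z⁻¹ * h * z) * (g⁻¹ * h * g)⁻¹ * (z⁻¹ * h * z) :=
    calc _ = g⁻¹ * (z⁻¹ * ((z * g)⁻¹ * h * (z * g)) * z) * g := by group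
      _ = g⁻¹ * ((z * z)⁻¹ * h * (z * z)) * g := by rw [hzg]; group
      _ = (g⁻¹ * (z⁻¹ * h * z) * g) * (g⁻¹ * h * g)⁻¹ * (g⁻¹ * (z⁻¹ * h * z) * g) := by
        rw [h₁]; group
      _ = _ := by rw [hb]
  have h₄ : g⁻¹ * h * g = h :=
    inv_injective (mul_left_cancel (mul_right_cancel (h₃.symm.trans h₂)))
  rw [mul_assoc, inv_mul_eq_iff_eq_mul] at h₄
  exact h₄.symm


/-- For a finite group `G`, the commuting graph equals the conjugacy super-commuting graph
(i.e. whenever some conjugate of `g` commutes with some conjugate of `h`, already `g` and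
`h` commute) if and only if `G` is a 2-Engel group, i.e. `[[x, y], y] = 1` for all `x, y`,
where `[x, y] = x⁻¹ y⁻¹ x y`. -/
theorem stmt8 {G : Type*} [Group G] [Finite G] :
    (∀ g h : G, (∃ x y : G, Commute (x⁻¹ * g * x) (y⁻¹ * h * y)) → Commute g h) ↔
      (∀ x y : G, (x⁻¹ * y⁻¹ * x * y)⁻¹ * y⁻¹ * (x⁻¹ * y⁻¹ * x * y) * y = 1) := by
  constructor
  · intro h x y
    have hc : Commute y (x⁻¹ * y * x) := h _ _ ⟨1, x⁻¹, by simp [mul_assoc]⟩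
    have hcomm : Commute y (x⁻¹ * y⁻¹ * x * y) := by
      have := hc.inv_right.mul_right (Commute.refl y)
      simpa [mul_assoc] using this
    rw [mul_assoc _ (x⁻¹ * y⁻¹ * x * y), ← hcomm.eq]
    group
  · rintro hG g h ⟨x, y, hc⟩
    refine Commute.of_conj_of_two_engel hG (z := y * x⁻¹) ?_
    have := (Commute.conj_iff x).mpr hc
    simpa [mul_assoc] using this
end

section
/- Let G be a finite group. The following are equivalent: (1) for all g, h ∈ G, if there exist x, y ∈ G such that the subgroup ⟨x⁻¹ g x, y⁻¹ h y⟩ is nilpotent, then ⟨g, h⟩ is nilpotent; (2) G is nilpotent. -/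
open scoped Pointwise in
/-- An element of `p`-power order has a conjugate in any given Sylow `p`-subgroup. -/
theorem Sylow.exists_conj_mem {G : Type*} [Group G] [Finite G] {p : ℕ} [hp : Fact p.Prime]
    (P : Sylow p G) {g : G} (hg : ∃ k : ℕ, g ^ p ^ k = 1) : ∃ x : G, x⁻¹ * g * x ∈ P := by
  have hpg : IsPGroup p (Subgroup.zpowers g) := by
    obtain ⟨k, hk⟩ := hg
    obtain ⟨j, -, hj⟩ := (Nat.dvd_prime_pow hp.out).mp (orderOf_dvd_of_pow_eq_one hk)
    exact IsPGroup.of_card (n := j) (by rw [Nat.card_zpowers, hj])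
  obtain ⟨Q, hQ⟩ := hpg.exists_le_sylow
  obtain ⟨x, rfl⟩ := MulAction.exists_smul_eq G P Q
  refine ⟨x, ?_⟩
  change _ ∈ (P : Subgroup G)
  have h : g ∈ MulAut.conj x • (P : Subgroup G) := hQ (Subgroup.mem_zpowers g)
  simpa [Subgroup.mem_pointwise_smul_iff_inv_smul_mem, mul_assoc] using h

/-- In a finite nilpotent group, the product of two elements of `p`-power order has
`p`-power order. -/
theorem Group.IsNilpotent.exists_mul_pow_eq_one {N : Type*} [Group N] [Finite N]
    (hN : Group.IsNilpotent N) {p : ℕ} [hp : Fact p.Prime] {a b : N}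
    (ha : ∃ k : ℕ, a ^ p ^ k = 1) (hb : ∃ k : ℕ, b ^ p ^ k = 1) :
    ∃ k : ℕ, (a * b) ^ p ^ k = 1 := by
  obtain ⟨P⟩ : Nonempty (Sylow p N) := inferInstance
  have hnorm : (P : Subgroup N).Normal := inferInstance
  have mem {c : N} (hc : ∃ k : ℕ, c ^ p ^ k = 1) : c ∈ P := by
    obtain ⟨x, hx⟩ := P.exists_conj_mem hc
    change c ∈ (P : Subgroup N)
    simpa [mul_assoc] using hnorm.conj_mem _ hx x
  obtain ⟨k, hk⟩ := P.isPGroup' ⟨a * b, mul_mem (mem ha) (mem hb)⟩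
  exact ⟨k, congrArg Subtype.val hk⟩

/-- For a finite group `G`, the nilpotent graph equals the conjugacy super-nilpotent graph
(i.e. whenever `⟨x⁻¹ g x, y⁻¹ h y⟩` is nilpotent for some `x, y`, already `⟨g, h⟩` is
nilpotent) if and only if `G` is nilpotent. -/
theorem stmt9 {G : Type*} [Group G] [Finite G] :
    (∀ g h : G,
        (∃ x y : G, Group.IsNilpotent ↥(Subgroup.closure {x⁻¹ * g * x, y⁻¹ * h * y})) →
        Group.IsNilpotent ↥(Subgroup.closure {g, h})) ↔
      Group.IsNilpotent G := by
  refine ⟨fun H => ?_, fun _ g h _ => inferInstance⟩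
  refine ((Group.isNilpotent_of_finite_tfae (G := G)).out 0 3).mpr fun p hp P => ?_
  have := hp
  let K : Subgroup G :=
    { carrier := {g | ∃ k : ℕ, g ^ p ^ k = 1}
      one_mem' := ⟨0, one_pow _⟩
      inv_mem' := fun ⟨k, hk⟩ => ⟨k, by rw [inv_pow, hk, inv_one]⟩
      mul_mem' := by
        intro a b ha hb
        obtain ⟨x, hx⟩ := P.exists_conj_mem ha
        obtain ⟨y, hy⟩ := P.exists_conj_mem hb
        have hle : Subgroup.closure {x⁻¹ * a * x, y⁻¹ * b * y} ≤ (P : Subgroup G) := by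
          rw [Subgroup.closure_le]
          rintro _ (rfl | rfl)
          exacts [hx, hy]
        have hN := H a b ⟨x, y, (P.isPGroup'.to_le hle).isNilpotent⟩
        obtain ⟨i, hi⟩ := ha
        obtain ⟨j, hj⟩ := hb
        obtain ⟨k, hk⟩ := hN.exists_mul_pow_eq_one (p := p)
          (a := ⟨a, Subgroup.subset_closure (by simp)⟩)
          (b := ⟨b, Subgroup.subset_closure (by simp)⟩)
          ⟨i, Subtype.ext hi⟩ ⟨j, Subtype.ext hj⟩
        exact ⟨k, congrArg Subtype.val hk⟩ }
  have hK : IsPGroup p K := fun ⟨_, k, hk⟩ => ⟨k, Subtype.ext hk⟩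
  have hPK : K = P := P.is_maximal' hK fun g hg =>
    (P.isPGroup' ⟨g, hg⟩).imp fun _ hk => congrArg Subtype.val hk
  rw [← hPK]
  exact ⟨fun g ⟨k, hk⟩ x => ⟨k, by rw [conj_pow, hk, mul_one, mul_inv_cancel]⟩⟩
end

section
/- Let G be a finite non-nilpotent group, and let nil(G) = {g ∈ G : ⟨g, x⟩ is nilpotent for all x ∈ G}. The subgraph of the nilpotent conjugacy class graph of G induced on the conjugacy classes of elements outside nil(G) has no edges (i.e., for any a, b ∉ nil(G) lying in distinct conjugacy classes, there are no conjugates x of a and y of b with ⟨x, y⟩ nilpotent) if and only if G is isomorphic to the symmetric group S₃ of degree 3. -/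
open Subgroup Group
open scoped commutatorElement

/-- `a` generates a nilpotent subgroup together with every element of the group. -/
def GeneratesNilpotents {G : Type*} [Group G] (a : G) : Prop :=
  ∀ x : G, IsNilpotent ↥(closure {a, x})

/-- The nilpotent conjugacy class graph of `G` has no edge outside `nil(G)`. -/
def NCCEdgeless (G : Type*) [Group G] : Prop :=
  ∀ a b : G, ¬ GeneratesNilpotents a → ¬ GeneratesNilpotents b → ¬ IsConj a b →
    ∀ x y : G, IsConj a x → IsConj b y → ¬ IsNilpotent ↥(closure {x, y})

section Closure

variable {G : Type*} [Group G]

theorem Commute.isNilpotent_closure_pair {a b : G} (h : Commute a b) :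
    IsNilpotent ↥(closure {a, b}) := by
  have : IsMulCommutative ↥(closure {a, b}) := by
    refine isMulCommutative_closure ?_
    rintro x (rfl | rfl) y (rfl | rfl)
    exacts [rfl, h, h.symm, rfl]
  let : CommGroup ↥(closure {a, b}) := { mul_comm := this.is_comm.comm }
  exact CommGroup.isNilpotent

theorem GeneratesNilpotents.one : GeneratesNilpotents (1 : G) := fun x =>
  (Commute.one_left x).isNilpotent_closure_pair

theorem Subgroup.isNilpotent_of_le {H K : Subgroup G} (h : H ≤ K) (hK : IsNilpotent K) :
    IsNilpotent H :=
  Group.nilpotent_of_mulEquiv (subgroupOfEquivOfLe h)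

theorem GeneratesNilpotents.pow {a : G} (h : GeneratesNilpotents a) (n : ℕ) :
    GeneratesNilpotents (a ^ n) := fun x => by
  refine Subgroup.isNilpotent_of_le ?_ (h x)
  rw [closure_le]
  rintro y (rfl | rfl)
  · exact pow_mem (subset_closure (by simp)) n
  · exact subset_closure (by simp)

theorem isNilpotent_closure_pair_map {H : Type*} [Group H] (f : G →* H) {a b : G}
    (h : IsNilpotent ↥(closure {a, b})) : IsNilpotent ↥(closure {f a, f b}) := by
  have e : closure {f a, f b} = (closure {a, b}).map f := by
    rw [MonoidHom.map_closure, Set.image_pair]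
  rw [e]
  exact Group.nilpotent_of_surjective (f.subgroupMap _) (f.subgroupMap_surjective _)

theorem isNilpotent_closure_pair_of_map {H : Type*} [Group H] (f : G →* H)
    (hf : f.ker ≤ center G) {a b : G} (h : IsNilpotent ↥(closure {f a, f b})) :
    IsNilpotent ↥(closure {a, b}) := by
  have e : closure {f a, f b} = (closure {a, b}).map f := by
    rw [MonoidHom.map_closure, Set.image_pair]
  rw [e] at h
  refine Subgroup.isNilpotent_of_ker_le_center (f.subgroupMap (closure {a, b})) ?_
  intro x hx
  have hx' : f x = 1 := congrArg Subtype.val (MonoidHom.mem_ker.1 hx)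
  have := mem_center_iff.1 (hf (MonoidHom.mem_ker.2 hx'))
  rw [mem_center_iff]
  exact fun y => Subtype.ext (this y)

theorem generatesNilpotents_map_iff {H : Type*} [Group H] (f : G →* H)
    (hf : f.ker ≤ center G) (hs : Function.Surjective f) (a : G) :
    GeneratesNilpotents (f a) ↔ GeneratesNilpotents a := by
  refine ⟨fun h x => isNilpotent_closure_pair_of_map f hf (h (f x)), fun h y => ?_⟩
  obtain ⟨x, rfl⟩ := hs y
  exact isNilpotent_closure_pair_map f (h x)

theorem NCCEdgeless.of_surjective {H : Type*} [Group H] (hG : NCCEdgeless G) (f : G →* H)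
    (hf : f.ker ≤ center G) (hs : Function.Surjective f) : NCCEdgeless H := by
  intro a b ha hb hab x y hx hy hn
  obtain ⟨a, rfl⟩ := hs a
  obtain ⟨b, rfl⟩ := hs b
  obtain ⟨c, rfl⟩ := isConj_iff.1 hx
  obtain ⟨d, rfl⟩ := isConj_iff.1 hy
  obtain ⟨c, rfl⟩ := hs c
  obtain ⟨d, rfl⟩ := hs d
  rw [generatesNilpotents_map_iff f hf hs] at ha hb
  refine hG a b ha hb (fun h => hab (f.map_isConj h)) (c * a * c⁻¹) (d * b * d⁻¹)
    (isConj_iff.2 ⟨c, rfl⟩) (isConj_iff.2 ⟨d, rfl⟩) (isNilpotent_closure_pair_of_map f hf ?_)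
  rwa [map_mul, map_mul, map_mul, map_mul, map_inv, map_inv]

/-- Some nontrivial element of a nilpotent `⟨x, y⟩` commutes with both generators. -/
theorem exists_commute_of_isNilpotent_closure_pair {x y : G} (hx : x ≠ 1)
    (h : IsNilpotent ↥(closure {x, y})) : ∃ w : G, w ≠ 1 ∧ Commute w x ∧ Commute w y := by
  have hxm : x ∈ closure {x, y} := subset_closure (by simp)
  have hym : y ∈ closure {x, y} := subset_closure (by simp)
  have : Nontrivial ↥(closure {x, y}) := ⟨⟨x, hxm⟩, 1, fun e => hx (congrArg Subtype.val e)⟩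
  obtain ⟨w, hw, hw1⟩ := (bot_or_exists_ne_one (center ↥(closure {x, y}))).resolve_left
    (Group.IsNilpotent.center_ne_bot _)
  rw [mem_center_iff] at hw
  exact ⟨w, fun e => hw1 (Subtype.ext e), (congrArg Subtype.val (hw ⟨x, hxm⟩)).symm,
    (congrArg Subtype.val (hw ⟨y, hym⟩)).symm⟩

end Closure

section PermFinThree

set_option synthInstance.maxSize 10000 in
theorem Equiv.Perm.fin_three_isConj_of_commute : ∀ w x y : Equiv.Perm (Fin 3), w ≠ 1 →
    w * x = x * w → w * y = y * w → x = 1 ∨ y = 1 ∨ ∃ c, c * x * c⁻¹ = y := by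
  decide

theorem isConj_of_isNilpotent_closure_pair {G : Type*} [Group G]
    (e : G ≃* Equiv.Perm (Fin 3)) {x y : G} (hx : x ≠ 1) (hy : y ≠ 1)
    (h : IsNilpotent ↥(closure {x, y})) : IsConj x y := by
  obtain ⟨w, hw, hwx, hwy⟩ := exists_commute_of_isNilpotent_closure_pair hx h
  obtain h1 | h1 | ⟨c, hc⟩ := Equiv.Perm.fin_three_isConj_of_commute (e w) (e x) (e y)
    (by simpa using hw) (hwx.map e) (hwy.map e)
  · exact absurd (by simpa using h1) hx
  · exact absurd (by simpa using h1) hy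
  · exact isConj_iff.2 ⟨e.symm c, e.injective (by simpa using hc)⟩

theorem nccEdgeless_of_mulEquiv_perm_fin_three {G : Type*} [Group G]
    (e : G ≃* Equiv.Perm (Fin 3)) : NCCEdgeless G := by
  intro a b ha hb hab x y hx hy hn
  have hx1 : x ≠ 1 := by
    rintro rfl
    exact ha (isConj_one_left.1 hx ▸ GeneratesNilpotents.one)
  have hy1 : y ≠ 1 := by
    rintro rfl
    exact hb (isConj_one_left.1 hy ▸ GeneratesNilpotents.one)
  exact hab ((hx.trans (isConj_of_isNilpotent_closure_pair e hx1 hy1 hn)).trans hy.symm)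

end PermFinThree

section TrivialCenter

variable {G : Type*} [Group G]

theorem isPGroup_zpowers {p k : ℕ} {g : G} (h : g ^ p ^ k = 1) : IsPGroup p (zpowers g) := by
  rintro ⟨_, n, rfl⟩
  refine ⟨k, Subtype.ext ?_⟩
  change (g ^ n) ^ p ^ k = 1
  rw [← zpow_natCast, ← zpow_mul, mul_comm, zpow_mul, zpow_natCast, h, one_zpow]

theorem Sylow.exists_mem_of_pow_eq_one {p k : ℕ} {g : G} (h : g ^ p ^ k = 1) :
    ∃ P : Sylow p G, g ∈ P := by
  obtain ⟨P, hP⟩ := (isPGroup_zpowers h).exists_le_sylow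
  exact ⟨P, hP (mem_zpowers g)⟩

theorem Group.IsNilpotent.commute_of_pow_eq_one [Finite G] [IsNilpotent G] {p q k m : ℕ}
    [Fact p.Prime] [Fact q.Prime] (hpq : p ≠ q) {g x : G} (hg : g ^ p ^ k = 1)
    (hx : x ^ q ^ m = 1) : Commute g x := by
  obtain ⟨P, hP⟩ := Sylow.exists_mem_of_pow_eq_one hg
  obtain ⟨Q, hQ⟩ := Sylow.exists_mem_of_pow_eq_one hx
  exact commute_of_normal_of_disjoint (P : Subgroup G) (Q : Subgroup G) inferInstance inferInstance
    (IsPGroup.disjoint_of_ne p q hpq _ _ P.2 Q.2) g x hP hQ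

theorem Subgroup.Normal.exists_mem_center_of_isNilpotent [IsNilpotent G] {K : Subgroup G}
    [hK : K.Normal] (hne : ∃ k ∈ K, k ≠ 1) : ∃ z ∈ K, z ∈ center G ∧ z ≠ 1 := by
  have key : ∀ n, ∀ k ∈ K, k ∈ upperCentralSeries G n → k ≠ 1 →
      ∃ z ∈ K, z ∈ center G ∧ z ≠ 1 := by
    intro n
    induction n with
    | zero =>
      intro k _ hk hk1
      exact absurd (by simpa using hk) hk1
    | succ n ih =>
      intro k hkK hk hk1
      by_cases hc : k ∈ center G
      · exact ⟨k, hkK, hc, hk1⟩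
      · obtain ⟨y, hy⟩ : ∃ y, y * k ≠ k * y := by
          simpa [mem_center_iff] using hc
        refine ih ⁅k, y⁆ ?_ (mem_upperCentralSeries_succ_iff.1 hk y) ?_
        · rw [commutatorElement_def, mul_assoc, mul_assoc, ← mul_assoc y]
          exact mul_mem hkK (hK.conj_mem _ (inv_mem hkK) y)
        · rw [Ne, commutatorElement_eq_one_iff_mul_comm]
          exact fun h => hy h.symm
  obtain ⟨n, hn⟩ := IsNilpotent.nilpotent G
  obtain ⟨k, hk, hk1⟩ := hne
  exact key n k hk (hn ▸ mem_top k) hk1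

theorem Subgroup.eq_top_of_sylow_le [Finite G] {H : Subgroup G}
    (h : ∀ (p : ℕ) [Fact p.Prime], ∃ P : Sylow p G, (P : Subgroup G) ≤ H) : H = ⊤ := by
  by_contra hH
  obtain ⟨p, hp, hpd⟩ := Nat.exists_prime_and_dvd (mt index_eq_one.1 hH)
  have : Fact p.Prime := ⟨hp⟩
  obtain ⟨P, hP⟩ := h p
  exact P.not_dvd_index (hpd.trans (index_dvd_of_le hP))

theorem GeneratesNilpotents.exists_mem_center [Finite G] {g : G} (hg : GeneratesNilpotents g)
    (hg1 : g ≠ 1) : ∃ z ∈ center G, z ≠ 1 := by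
  obtain ⟨p, hp, hpd⟩ := Nat.exists_prime_and_dvd (mt orderOf_eq_one_iff.1 hg1)
  have : Fact p.Prime := ⟨hp⟩
  set u := g ^ (orderOf g / p) with hu
  have hup : orderOf u = p := orderOf_pow_orderOf_div (orderOf_pos g).ne' hpd
  have hun : GeneratesNilpotents u := hg.pow _
  have hu1 : u ≠ 1 := by
    intro h
    rw [h, orderOf_one] at hup
    exact hp.one_lt.ne hup
  have hupow : u ^ p ^ 1 = 1 := by
    rw [pow_one, ← hup, pow_orderOf_eq_one]
  let S : Set G := {x | ∃ q m : ℕ, q.Prime ∧ p ≠ q ∧ x ^ q ^ m = 1}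
  have hSn : (centralizer S).Normal := by
    refine ⟨fun n hn y => ?_⟩
    rw [mem_centralizer_iff] at hn ⊢
    rintro h ⟨q, m, hq, hpq, hh⟩
    have := hn (y⁻¹ * h * y) ⟨q, m, hq, hpq, by
      have := conj_pow (a := y⁻¹) (b := h) (i := q ^ m)
      rw [inv_inv] at this
      simp [this, hh]⟩
    have h2 := congrArg (fun t => y * t * y⁻¹) this
    simpa [mul_assoc] using h2
  have huS : u ∈ centralizer S := by
    rw [mem_centralizer_iff]
    rintro x ⟨q, m, hq, hpq, hx⟩
    have : Fact q.Prime := ⟨hq⟩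
    have := hun x
    have hc := IsNilpotent.commute_of_pow_eq_one (G := ↥(closure {u, x})) hpq
      (g := ⟨u, subset_closure (by simp)⟩) (x := ⟨x, subset_closure (by simp)⟩)
      (Subtype.ext hupow) (Subtype.ext hx)
    exact (congrArg Subtype.val hc).symm
  obtain ⟨P, hP⟩ := Sylow.exists_mem_of_pow_eq_one hupow
  have : IsNilpotent P := P.2.isNilpotent
  obtain ⟨z, hzS, hzc, hz1⟩ := Subgroup.Normal.exists_mem_center_of_isNilpotent
    (K := (centralizer S).subgroupOf (P : Subgroup G))
    ⟨⟨u, hP⟩, mem_subgroupOf.2 huS, fun h => hu1 (congrArg Subtype.val h)⟩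
  refine ⟨z, ?_, fun h => hz1 (Subtype.ext h)⟩
  have htop : centralizer {(z : G)} = ⊤ := by
    refine Subgroup.eq_top_of_sylow_le fun q hq => ?_
    by_cases hpq : p = q
    · subst hpq
      refine ⟨P, fun y hy => mem_centralizer_singleton_iff.2 ?_⟩
      exact congrArg Subtype.val (mem_center_iff.1 hzc ⟨y, hy⟩)
    · refine ⟨default, fun y hy => mem_centralizer_singleton_iff.2 ?_⟩
      obtain ⟨m, hm⟩ := (default : Sylow q G).2 ⟨y, hy⟩
      exact mem_centralizer_iff.1 (mem_subgroupOf.1 hzS) y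
        ⟨q, m, hq.out, hpq, congrArg Subtype.val hm⟩
  rw [mem_center_iff]
  intro y
  exact mem_centralizer_singleton_iff.1 (htop ▸ mem_top y)

end TrivialCenter

section CommutingElementsConjugate

variable {G : Type*} [Group G]

theorem IsConj.orderOf_eq {a b : G} (h : IsConj a b) : orderOf a = orderOf b := by
  obtain ⟨c, rfl⟩ := isConj_iff.1 h
  exact (orderOf_injective (MulAut.conj c).toMonoidHom (MulAut.conj c).injective a).symm

theorem orderOf_mul_ncard_conjugatesOf_dvd [Finite G] (g : G) :
    orderOf g * (conjugatesOf g).ncard ∣ Nat.card G := by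
  have h1 : (MulAction.stabilizer (ConjAct G) g).index = (conjugatesOf g).ncard := by
    rw [MulAction.index_stabilizer, ConjAct.orbit_eq_carrier_conjClasses]
    rfl
  have h2 : zpowers (ConjAct.toConjAct g) ≤ MulAction.stabilizer (ConjAct G) g := by
    rw [zpowers_le, MulAction.mem_stabilizer_iff, ConjAct.toConjAct_smul]
    simp
  have h3 := card_dvd_of_le h2
  rw [Nat.card_zpowers] at h3
  have h4 : orderOf (ConjAct.toConjAct g) = orderOf g :=
    orderOf_injective (ConjAct.toConjAct (G := G)).toMonoidHom (ConjAct.toConjAct).injective g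
  rw [h4] at h3
  have h5 := (MulAction.stabilizer (ConjAct G) g).card_mul_index
  rw [h1] at h5
  exact (mul_dvd_mul_right h3 _).trans (dvd_of_eq h5)

variable [Finite G]

theorem orderOf_prime_of_commute_isConj
    (hc : ∀ a b : G, a ≠ 1 → b ≠ 1 → Commute a b → IsConj a b)
    {a : G} (ha : a ≠ 1) : (orderOf a).Prime := by
  obtain ⟨p, hp, k, hk⟩ := Nat.exists_prime_and_dvd (mt orderOf_eq_one_iff.1 ha)
  have hpos := orderOf_pos a
  by_cases h : a ^ p = 1
  · rwa [orderOf_eq_prime (hp := ⟨hp⟩) h ha]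
  · have h1 := (hc a (a ^ p) ha h ((Commute.refl a).pow_right p)).orderOf_eq
    rw [orderOf_pow_of_dvd hp.ne_zero ⟨k, hk⟩] at h1
    exact absurd h1 (Nat.div_lt_self hpos hp.one_lt).ne'

theorem isConj_of_orderOf_eq_of_commute_isConj
    (hc : ∀ a b : G, a ≠ 1 → b ≠ 1 → Commute a b → IsConj a b)
    {p : ℕ} (hp : p.Prime) {a b : G}
    (ha : orderOf a = p) (hb : orderOf b = p) : IsConj a b := by
  have : Fact p.Prime := ⟨hp⟩
  have ne_one {a : G} (ha : orderOf a = p) : a ≠ 1 := by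
    rintro rfl
    rw [orderOf_one] at ha
    exact hp.one_lt.ne ha
  have pow_one {a : G} (ha : orderOf a = p) : a ^ p ^ 1 = 1 := by
    rw [_root_.pow_one, ← ha, pow_orderOf_eq_one]
  obtain ⟨P, hP⟩ := Sylow.exists_mem_of_pow_eq_one (pow_one ha)
  obtain ⟨Q, hQ⟩ := Sylow.exists_mem_of_pow_eq_one (pow_one hb)
  obtain ⟨g, rfl⟩ := MulAction.exists_smul_eq G Q P
  have hb' : MulAut.conj g b ∈ g • Q := by
    rw [Sylow.smul_def]
    exact Subgroup.smul_mem_pointwise_smul b (MulAut.conj g) (Q : Subgroup G) hQ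
  have hbc : IsConj b (MulAut.conj g b) := isConj_iff.2 ⟨g, rfl⟩
  have hb1 : MulAut.conj g b ≠ 1 := by simpa using ne_one hb
  have : Nontrivial ↥(g • Q) := ⟨⟨a, hP⟩, 1, fun e => ne_one ha (congrArg Subtype.val e)⟩
  obtain ⟨z, hz, hz1⟩ := (bot_or_exists_ne_one (center ↥(g • Q))).resolve_left
    (IsPGroup.bot_lt_center (g • Q).2).ne'
  have hz1 : (z : G) ≠ 1 := fun e => hz1 (Subtype.ext e)
  rw [mem_center_iff] at hz
  have h1 : IsConj a z := hc a z (ne_one ha) hz1 (congrArg Subtype.val (hz ⟨a, hP⟩))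
  have h2 : IsConj (MulAut.conj g b) z := hc _ z hb1 hz1 (congrArg Subtype.val (hz ⟨_, hb'⟩))
  exact (h1.trans h2.symm).trans hbc.symm

theorem orderOf_eq_two_or_three_of_commute_isConj
    (hc : ∀ a b : G, a ≠ 1 → b ≠ 1 → Commute a b → IsConj a b)
    {a : G} (ha : a ≠ 1) :
    orderOf a = 2 ∨ orderOf a = 3 := by
  have hp := orderOf_prime_of_commute_isConj hc ha
  set p := orderOf a with hpa
  have : Fact p.Prime := ⟨hp⟩
  obtain ⟨u, hu⟩ := IsCyclic.exists_generator (α := (ZMod p)ˣ)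
  have hou : orderOf u = p - 1 := by
    rw [orderOf_eq_card_of_forall_mem_zpowers hu, Nat.card_eq_fintype_card, ZMod.card_units]
  set j : ℕ := (u : ZMod p).val with hj
  have hju : (j : ZMod p) = u := ZMod.natCast_zmod_val _
  have haj : a ^ j ≠ 1 := by
    intro h
    have := orderOf_dvd_of_pow_eq_one h
    rw [← hpa, ← ZMod.natCast_eq_zero_iff, hju] at this
    exact u.ne_zero this
  obtain ⟨g, hg⟩ := isConj_iff.1 (hc a (a ^ j) ha haj ((Commute.refl a).pow_right j))
  have hgm : ∀ m : ℕ, g ^ m * a * (g ^ m)⁻¹ = a ^ j ^ m := by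
    intro m
    induction m with
    | zero => simp
    | succ m ih =>
      calc g ^ (m + 1) * a * (g ^ (m + 1))⁻¹ = g ^ m * (g * a * g⁻¹) * (g ^ m)⁻¹ := by
            rw [pow_succ]; group
        _ = (a ^ j ^ m) ^ j := by rw [hg, ← conj_pow, ih]
        _ = a ^ j ^ (m + 1) := by rw [← pow_mul, pow_succ]
  have h1 : a ^ j ^ orderOf g = a ^ 1 := by
    rw [← hgm, pow_orderOf_eq_one]
    simp
  rw [pow_eq_pow_iff_modEq, ← hpa, ← ZMod.natCast_eq_natCast_iff, Nat.cast_pow, hju,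
    Nat.cast_one, ← Units.val_pow_eq_pow_val, Units.val_eq_one] at h1
  have h2 : p - 1 ∣ orderOf g := hou ▸ orderOf_dvd_of_pow_eq_one h1
  have hp2 := hp.two_le
  by_cases hg1 : g = 1
  · rw [hg1, orderOf_one, Nat.dvd_one] at h2
    lia
  · rcases (Nat.dvd_prime (orderOf_prime_of_commute_isConj hc hg1)).1 h2 with h | h
    · lia
    · have h3 : (p - 1).Prime := h ▸ orderOf_prime_of_commute_isConj hc hg1
      rcases hp.eq_two_or_odd with h4 | h4
      · exact Or.inl h4
      · rcases h3.eq_two_or_odd with h5 | h5 <;> lia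

theorem exists_orderOf_eq_of_commute_isConj
    (hc : ∀ a b : G, a ≠ 1 → b ≠ 1 → Commute a b → IsConj a b)
    (hG : ¬ IsNilpotent G) :
    (∃ t : G, orderOf t = 2) ∧ ∃ u : G, orderOf u = 3 := by
  have key : ∀ p : ℕ, p.Prime → ∃ a : G, a ≠ 1 ∧ orderOf a ≠ p := by
    intro p hp
    by_contra! h
    have : Fact p.Prime := ⟨hp⟩
    refine hG (IsPGroup.isNilpotent (p := p) (IsPGroup.iff_orderOf.2 fun g => ?_))
    by_cases hg : g = 1
    · exact ⟨0, by simp [hg]⟩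
    · exact ⟨1, by rw [h g hg, pow_one]⟩
  obtain ⟨a, ha1, ha⟩ := key 3 Nat.prime_three
  obtain ⟨b, hb1, hb⟩ := key 2 Nat.prime_two
  exact ⟨⟨a, (orderOf_eq_two_or_three_of_commute_isConj hc ha1).resolve_right ha⟩,
    ⟨b, (orderOf_eq_two_or_three_of_commute_isConj hc hb1).resolve_left hb⟩⟩

theorem card_eq_six_of_commute_isConj
    (hc : ∀ a b : G, a ≠ 1 → b ≠ 1 → Commute a b → IsConj a b)
    {t u : G} (ht : orderOf t = 2) (hu : orderOf u = 3) :
    Nat.card G = 6 := by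
  have huniv : (Set.univ : Set G) ⊆ {1} ∪ (conjugatesOf t ∪ conjugatesOf u) := by
    intro x _
    by_cases hx : x = 1
    · exact Or.inl hx
    · rcases orderOf_eq_two_or_three_of_commute_isConj hc hx with h | h
      · exact Or.inr (Or.inl (isConj_of_orderOf_eq_of_commute_isConj hc Nat.prime_two ht h))
      · exact Or.inr (Or.inr (isConj_of_orderOf_eq_of_commute_isConj hc Nat.prime_three hu h))
  have h1 : Nat.card G ≤ 1 + ((conjugatesOf t).ncard + (conjugatesOf u).ncard) := by
    rw [← Set.ncard_univ, ← Set.ncard_singleton (1 : G)]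
    exact (Set.ncard_le_ncard huniv (Set.toFinite _)).trans <| (Set.ncard_union_le _ _).trans <|
      Nat.add_le_add_left (Set.ncard_union_le _ _) _
  have hpos : 0 < Nat.card G := Nat.card_pos
  have h2 := Nat.le_of_dvd hpos (orderOf_mul_ncard_conjugatesOf_dvd t)
  have h3 := Nat.le_of_dvd hpos (orderOf_mul_ncard_conjugatesOf_dvd u)
  have h4 := orderOf_dvd_natCard t
  have h5 := orderOf_dvd_natCard u
  rw [ht] at h2 h4
  rw [hu] at h3 h5
  lia

theorem nonempty_mulEquiv_perm_fin_three_of_commute_isConj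
    (hc : ∀ a b : G, a ≠ 1 → b ≠ 1 → Commute a b → IsConj a b)
    (hG : ¬ IsNilpotent G) :
    Nonempty (G ≃* Equiv.Perm (Fin 3)) := by
  obtain ⟨⟨t, ht⟩, u, hu⟩ := exists_orderOf_eq_of_commute_isConj hc hG
  have hcard := card_eq_six_of_commute_isConj hc ht hu
  have ht1 : t ≠ 1 := by
    rintro rfl
    simp at ht
  have hu1 : u ≠ 1 := by
    rintro rfl
    simp at hu
  have hmem : ∀ x ∈ zpowers t, x = 1 ∨ x = t := by
    intro x hx
    classical
    rw [mem_zpowers_iff_mem_range_orderOf, ht] at hx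
    simpa [Finset.range_add_one, eq_comm, or_comm] using hx
  have hker : (MulAction.toPermHom G (G ⧸ zpowers t)).ker = ⊥ := by
    rw [← normalCore_eq_ker, eq_bot_iff]
    intro x hx
    rcases hmem x (normalCore_le _ hx) with h | rfl
    · exact h
    · exfalso
      rcases hmem _ (hx u) with h | h
      · exact ht1 (by simpa using h)
      · have := (hc x u ht1 hu1 (mul_inv_eq_iff_eq_mul.1 h).symm).orderOf_eq
        lia
  have hindex : Nat.card (G ⧸ zpowers t) = 3 := by
    have := card_eq_card_quotient_mul_card_subgroup (zpowers t)
    rw [Nat.card_zpowers, ht, hcard] at this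
    lia
  obtain ⟨e⟩ : Nonempty ((G ⧸ zpowers t) ≃ Fin 3) :=
    ⟨Finite.equivFinOfCardEq hindex⟩
  let f : G →* Equiv.Perm (Fin 3) :=
    e.permCongrHom.toMonoidHom.comp (MulAction.toPermHom G (G ⧸ zpowers t))
  have hf : Function.Injective f :=
    e.permCongrHom.injective.comp ((MonoidHom.ker_eq_bot_iff _).1 hker)
  refine ⟨MulEquiv.ofBijective f ((Nat.bijective_iff_injective_and_card f).2 ⟨hf, ?_⟩)⟩
  rw [hcard, Nat.card_perm, Nat.card_fin]
  rfl

end CommutingElementsConjugate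

section CenterQuotient

variable {G : Type*} [Group G]

theorem center_eq_bot_of_quotient_mulEquiv_perm_fin_three (hG : NCCEdgeless G)
    (e : G ⧸ center G ≃* Equiv.Perm (Fin 3)) : center G = ⊥ := by
  rw [eq_bot_iff]
  intro z hz
  rw [mem_bot]
  let f : G →* Equiv.Perm (Fin 3) := e.toMonoidHom.comp (QuotientGroup.mk' (center G))
  have hs : Function.Surjective f :=
    e.surjective.comp (QuotientGroup.mk'_surjective (center G))
  have hker : f.ker = center G := by
    ext x
    simp [f]
  obtain ⟨a, ha⟩ := hs (Equiv.swap 0 1)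
  have hfaz : f (a * z) = f a := by
    rw [map_mul, MonoidHom.mem_ker.1 (hker.ge hz), mul_one]
  have hna : ¬ GeneratesNilpotents (f a) := by
    intro h
    have h1 := isConj_of_isNilpotent_closure_pair (MulEquiv.refl _) (by rw [ha]; decide)
      (by decide) (h (Equiv.swap 0 1 * Equiv.swap 1 2))
    rw [ha] at h1
    revert h1
    rw [isConj_iff]
    decide
  have hcomm : Commute a (a * z) :=
    (Commute.refl a).mul_right (mem_center_iff.1 hz a)
  have hconj : IsConj a (a * z) := by
    by_contra h
    refine hG a (a * z) ?_ ?_ h a (a * z) (.refl _) (.refl _) hcomm.isNilpotent_closure_pair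
    · rwa [← generatesNilpotents_map_iff f hker.le hs]
    · rwa [← generatesNilpotents_map_iff f hker.le hs, hfaz]
  obtain ⟨g, hg⟩ := isConj_iff.1 hconj
  have hfg : f g * f a = f a * f g := by
    have := congrArg f hg
    rw [hfaz, map_mul, map_mul, map_inv] at this
    exact mul_inv_eq_iff_eq_mul.1 this
  have hcent : ∀ x : Equiv.Perm (Fin 3), x * Equiv.swap 0 1 = Equiv.swap 0 1 * x →
      x = 1 ∨ x = Equiv.swap 0 1 := by
    decide
  have hga : Commute g a := by
    rcases hcent (f g) (ha ▸ hfg) with h | h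
    · have : g ∈ center G := hker ▸ MonoidHom.mem_ker.2 h
      exact (mem_center_iff.1 this a).symm
    · have : a⁻¹ * g ∈ center G := by
        rw [← hker, MonoidHom.mem_ker, map_mul, map_inv, ha, h, inv_mul_cancel]
      have h1 := mem_center_iff.1 this a
      rw [mul_inv_cancel_left] at h1
      have h2 : a * g = g * a := by simpa [mul_assoc] using congrArg (a * ·) h1
      exact h2.symm
  rw [hga.eq, mul_inv_cancel_right] at hg
  exact mul_eq_left.1 hg.symm

theorem NCCEdgeless.nonempty_mulEquiv_of_center_eq_bot [Finite G] (hn : ¬ IsNilpotent G)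
    (hG : NCCEdgeless G) (hz : center G = ⊥) : Nonempty (G ≃* Equiv.Perm (Fin 3)) := by
  refine nonempty_mulEquiv_perm_fin_three_of_commute_isConj (fun a b ha hb hab => ?_) hn
  have key : ∀ g : G, g ≠ 1 → ¬ GeneratesNilpotents g := by
    intro g hg h
    obtain ⟨z, hzc, hz1⟩ := h.exists_mem_center hg
    exact hz1 (mem_bot.1 (hz ▸ hzc))
  by_contra h
  exact hG a b (key a ha) (key b hb) h a b (.refl _) (.refl _) hab.isNilpotent_closure_pair

theorem NCCEdgeless.nonempty_mulEquiv_perm_fin_three {G : Type*} [Group G] [Finite G]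
    (hn : ¬ IsNilpotent G) (hG : NCCEdgeless G) : Nonempty (G ≃* Equiv.Perm (Fin 3)) := by
  by_cases hz : center G = ⊥
  · exact hG.nonempty_mulEquiv_of_center_eq_bot hn hz
  · have hlt : Nat.card (G ⧸ center G) < Nat.card G := by
      have h1 := card_eq_card_quotient_mul_card_subgroup (center G)
      have h2 := one_lt_card_iff_ne_bot (center G) |>.2 hz
      have h3 : 0 < Nat.card (G ⧸ center G) := Nat.card_pos
      rw [h1]
      exact lt_mul_of_one_lt_right h3 h2
    obtain ⟨e⟩ := NCCEdgeless.nonempty_mulEquiv_perm_fin_three (G := G ⧸ center G)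
      (fun h => hn (Group.of_quotient_center_nilpotent h))
      (hG.of_surjective (QuotientGroup.mk' (center G)) (QuotientGroup.ker_mk' _).le
        (QuotientGroup.mk'_surjective _))
    exact absurd (center_eq_bot_of_quotient_mulEquiv_perm_fin_three hG e) hz
termination_by Nat.card G

end CenterQuotient


/-- For a finite non-nilpotent group `G`, with
`nil(G) = {g : ∀ x, ⟨g, x⟩ is nilpotent}`, the subgraph of the nilpotent conjugacy class
graph induced on the classes of elements outside `nil(G)` is empty (has no edges) if and
only if `G ≅ S₃`. -/
theorem stmt16 {G : Type*} [Group G] [Finite G] (hG : ¬ Group.IsNilpotent G) :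
    (∀ a b : G,
        ¬ (∀ x : G, Group.IsNilpotent ↥(Subgroup.closure {a, x})) →
        ¬ (∀ x : G, Group.IsNilpotent ↥(Subgroup.closure {b, x})) →
        ¬ IsConj a b →
        ∀ x y : G, IsConj a x → IsConj b y →
          ¬ Group.IsNilpotent ↥(Subgroup.closure {x, y})) ↔
      Nonempty (G ≃* Equiv.Perm (Fin 3)) := by
  exact ⟨fun h => NCCEdgeless.nonempty_mulEquiv_perm_fin_three hG h,
    fun ⟨e⟩ => nccEdgeless_of_mulEquiv_perm_fin_three e⟩
end
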